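/- Let S_1,…,S_m and G_1,…,G_m (m ≥ 2) be contracting similitudes of ℝ^{w₁} and ℝ^{w₂} respectively, with compact sets K₁ ⊆ ℝ^{w₁}, K₂ ⊆ ℝ^{w₂} satisfying S_i(K₁) ⊆ K₁, G_i(K₂) ⊆ K₂ and pairwise disjoint images S_i(K₁) ∩ S_j(K₁) = ∅, G_i(K₂) ∩ G_j(K₂) = ∅ for i ≠ j; let Λ₁, Λ₂ be the two self-similar attractors with coding maps π₁, π₂. Let f : ℝ^{w₁} × ℝ^{w₂} → ℝ^{w₁} × ℝ^{w₂} be a map with invariant set Λ = Λ₁ × Λ₂ such that the map π : Σ̃ → Λ defined by π(s̃) = (π₁((s_k)_{k≥1}), π₂((s_{1−k})_{k≥1})) is a homeomorphism with f ∘ π = π ∘ σ. Then the Li-Yorke pairs of f in Λ have full Hausdorff dimension: dim_H LY_f(Λ) = dim_H(Λ × Λ) = 2·dim_H Λ₁ + 2·dim_H Λ₂. -/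

import Mathlib

open Filter Set

noncomputable section

/-- The shift map on two-sided sequences over `Fin m`. -/
def shiftZ {m : ℕ} (s : ℤ → Fin m) : ℤ → Fin m := fun k => s (k + 1)

/-- The composition `T_{s_1} ∘ ⋯ ∘ T_{s_{n+1}}` of the maps along the first `n + 1`
digits of the one-sided sequence `s` (with `0`-based indexing). -/
def iterComp {m : ℕ} {E : Type*} (S : Fin m → E → E) (s : ℕ → Fin m) : ℕ → E → E
  | 0 => S (s 0)
  | n + 1 => iterComp S s n ∘ S (s (n + 1))

/-- The set of Li-Yorke pairs of a map `f` inside an invariant set `Λ`. -/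
def liYorkePairs {E : Type*} [PseudoMetricSpace E] (f : E → E) (Λ : Set E) :
    Set (E × E) :=
  {p | p.1 ∈ Λ ∧ p.2 ∈ Λ ∧
    liminf (fun n : ℕ => dist (f^[n] p.1) (f^[n] p.2)) atTop = 0 ∧
    0 < limsup (fun n : ℕ => dist (f^[n] p.1) (f^[n] p.2)) atTop}

open MeasureTheory ProbabilityTheory Topology
open scoped NNReal ENNReal

/-- A measure is upper `s`-regular if sets of diameter at most `r` have mass `O(r ^ s)`. -/
def IsUpperRegular {X : Type*} [PseudoEMetricSpace X] [MeasurableSpace X]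
    (μ : Measure X) (s : ℝ≥0) : Prop :=
  ∃ C : ℝ≥0, ∀ (A : Set X) (r : ℝ≥0), 0 < r → Metric.ediam A ≤ r →
    μ A ≤ C * (r : ℝ≥0∞) ^ (s : ℝ)

/-- A measure is lower `s`-regular on `E` if balls of radius `r ≤ 1` centred in `E` have mass
at least a constant multiple of `r ^ s`. -/
def IsLowerRegular {X : Type*} [PseudoEMetricSpace X] [MeasurableSpace X]
    (μ : Measure X) (s : ℝ≥0) (E : Set X) : Prop :=
  ∃ C : ℝ≥0, ∀ x ∈ E, ∀ r : ℝ≥0, 0 < r → r ≤ 1 →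
    (r : ℝ≥0∞) ^ (s : ℝ) ≤ C * μ (Metric.closedEBall x r)

theorem IsUpperRegular.prod {X Y : Type*} [PseudoEMetricSpace X] [MeasurableSpace X]
    [PseudoEMetricSpace Y] [MeasurableSpace Y] {μ : Measure X} {ν : Measure Y} [SFinite ν]
    {s t : ℝ≥0} (hμ : IsUpperRegular μ s) (hν : IsUpperRegular ν t) :
    IsUpperRegular (μ.prod ν) (s + t) := by
  obtain ⟨C, hC⟩ := hμ
  obtain ⟨D, hD⟩ := hν
  refine ⟨C * D, fun A r hr hA => ?_⟩
  have h1 : Metric.ediam (Prod.fst '' A) ≤ r := by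
    rw [Metric.ediam_le_iff] at hA ⊢
    rintro _ ⟨x, hx, rfl⟩ _ ⟨y, hy, rfl⟩
    exact (le_max_left _ _).trans ((Prod.edist_eq x y).symm.trans_le (hA x hx y hy))
  have h2 : Metric.ediam (Prod.snd '' A) ≤ r := by
    rw [Metric.ediam_le_iff] at hA ⊢
    rintro _ ⟨x, hx, rfl⟩ _ ⟨y, hy, rfl⟩
    exact (le_max_right _ _).trans ((Prod.edist_eq x y).symm.trans_le (hA x hx y hy))
  calc μ.prod ν A ≤ μ.prod ν ((Prod.fst '' A) ×ˢ (Prod.snd '' A)) :=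
        measure_mono fun x hx => ⟨⟨x, hx, rfl⟩, ⟨x, hx, rfl⟩⟩
    _ = μ (Prod.fst '' A) * ν (Prod.snd '' A) := Measure.prod_prod _ _
    _ ≤ (C * (r : ℝ≥0∞) ^ (s : ℝ)) * (D * (r : ℝ≥0∞) ^ (t : ℝ)) :=
        mul_le_mul' (hC _ r hr h1) (hD _ r hr h2)
    _ = _ := by
        rw [NNReal.coe_add, ENNReal.rpow_add_of_nonneg _ _ s.coe_nonneg t.coe_nonneg,
          ENNReal.coe_mul]
        ring

theorem IsLowerRegular.prod {X Y : Type*} [PseudoEMetricSpace X] [MeasurableSpace X]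
    [PseudoEMetricSpace Y] [MeasurableSpace Y] {μ : Measure X} {ν : Measure Y} [SFinite ν]
    {s t : ℝ≥0} {E : Set X} {F : Set Y}
    (hμ : IsLowerRegular μ s E) (hν : IsLowerRegular ν t F) :
    IsLowerRegular (μ.prod ν) (s + t) (E ×ˢ F) := by
  obtain ⟨C, hC⟩ := hμ
  obtain ⟨D, hD⟩ := hν
  refine ⟨C * D, fun x hx r hr hr1 => ?_⟩
  have hball : Metric.closedEBall x (r : ℝ≥0∞) =
      Metric.closedEBall x.1 (r : ℝ≥0∞) ×ˢ Metric.closedEBall x.2 (r : ℝ≥0∞) := by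
    ext y
    simp [Prod.edist_eq]
  rw [hball, Measure.prod_prod, NNReal.coe_add,
    ENNReal.rpow_add_of_nonneg _ _ s.coe_nonneg t.coe_nonneg]
  calc _ ≤ (C * μ (Metric.closedEBall x.1 (r : ℝ≥0∞))) *
          (D * ν (Metric.closedEBall x.2 (r : ℝ≥0∞))) :=
        mul_le_mul' (hC _ hx.1 r hr hr1) (hD _ hx.2 r hr hr1)
    _ = _ := by
        rw [ENNReal.coe_mul]
        ring

/-- The mass distribution principle. -/
theorem IsUpperRegular.le_dimH {X : Type*} [EMetricSpace X] [MeasurableSpace X] [BorelSpace X]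
    {μ : Measure X} {s : ℝ≥0} (hμ : IsUpperRegular μ s) {E : Set X} (hE : μ E ≠ 0) :
    (s : ℝ≥0∞) ≤ dimH E := by
  obtain ⟨C, hC⟩ := hμ
  have hdiam : ∀ A : Set X, Metric.ediam A ≤ 1 →
      μ A ≤ ((C + 1 : ℝ≥0) : ℝ≥0∞) * Metric.ediam A ^ (s : ℝ) := by
    intro A hA
    obtain ⟨x, hx⟩ : ∃ x : ℝ≥0, (x : ℝ≥0∞) = Metric.ediam A :=
      ⟨_, ENNReal.coe_toNNReal (ne_top_of_le_ne_top ENNReal.one_ne_top hA)⟩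
    have hcont : Tendsto (fun r : ℝ≥0 => ((C + 1 : ℝ≥0) : ℝ≥0∞) * (r : ℝ≥0∞) ^ (s : ℝ))
        (𝓝[>] x) (𝓝 (((C + 1 : ℝ≥0) : ℝ≥0∞) * (x : ℝ≥0∞) ^ (s : ℝ))) := by
      refine ENNReal.Tendsto.const_mul ?_ (Or.inr ENNReal.coe_ne_top)
      exact ((ENNReal.continuous_rpow_const.comp ENNReal.continuous_coe).tendsto x).mono_left
        nhdsWithin_le_nhds
    rw [← hx]
    refine ge_of_tendsto hcont ?_
    filter_upwards [self_mem_nhdsWithin] with r hr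
    refine (hC A r (bot_le.trans_lt hr) ?_).trans ?_
    · rw [← hx]
      exact_mod_cast hr.le
    · gcongr
      exact le_self_add
  have hC0 : ((C + 1 : ℝ≥0) : ℝ≥0∞) ≠ 0 := by simp
  have hle : ((C + 1 : ℝ≥0) : ℝ≥0∞)⁻¹ • μ ≤ μH[(s : ℝ)] := by
    refine Measure.le_hausdorffMeasure _ _ 1 one_pos fun A hA => ?_
    rw [Measure.smul_apply, smul_eq_mul]
    calc _ ≤ ((C + 1 : ℝ≥0) : ℝ≥0∞)⁻¹ *
          (((C + 1 : ℝ≥0) : ℝ≥0∞) * Metric.ediam A ^ (s : ℝ)) := by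
          gcongr
          exact hdiam A hA
      _ = _ := by rw [← mul_assoc, ENNReal.inv_mul_cancel hC0 ENNReal.coe_ne_top, one_mul]
  refine le_dimH_of_hausdorffMeasure_ne_zero fun h0 => ?_
  have := hle E
  rw [h0, Measure.smul_apply, smul_eq_mul, nonpos_iff_eq_zero, mul_eq_zero] at this
  rcases this with h | h
  · exact ENNReal.inv_ne_zero.2 ENNReal.coe_ne_top h
  · exact hE h

theorem IsLowerRegular.dimH_le {X : Type*} [EMetricSpace X] [MeasurableSpace X] [BorelSpace X]
    {μ : Measure X} [IsFiniteMeasure μ] {s : ℝ≥0} {E : Set X}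
    (hμ : IsLowerRegular μ s E) (hE : IsCompact E) : dimH E ≤ s := by
  obtain ⟨C, hC⟩ := hμ
  let r : ℕ → ℝ≥0 := fun n => 1 / ((n : ℝ≥0) + 1)
  have hr0 : ∀ n, 0 < r n := fun n => by positivity
  have hr1 : ∀ n, r n ≤ 1 := fun n => by
    rw [div_le_one (by positivity)]
    simp
  have hpack : ∀ n, Metric.packingNumber (2 * r n) E ≠ ⊤ := by
    intro n
    obtain ⟨F, -, hFfin, hF⟩ := Metric.exists_finite_isCover_of_isCompact (hr0 n).ne' hE
    exact ne_top_of_le_ne_top (Set.encard_ne_top_iff.2 hFfin)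
      ((Metric.packingNumber_two_mul_le_externalCoveringNumber _ _).trans
        hF.externalCoveringNumber_le_encard)
  have hex : ∀ n, ∃ F : Finset X, (F : Set X) ⊆ E ∧
      Metric.IsSeparated ((2 * r n : ℝ≥0) : ℝ≥0∞) (F : Set X) ∧
      Metric.IsCover (2 * r n) E (F : Set X) := by
    intro n
    have hfin : (Metric.maximalSeparatedSet (2 * r n) E).Finite := by
      rw [← Set.encard_ne_top_iff, Metric.encard_maximalSeparatedSet (hpack n)]
      exact hpack n
    refine ⟨hfin.toFinset, ?_, ?_, ?_⟩ <;> rw [hfin.coe_toFinset]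
    · exact Metric.maximalSeparatedSet_subset
    · exact Metric.isSeparated_maximalSeparatedSet
    · exact Metric.isCover_maximalSeparatedSet (hpack n)
  choose F hFE hFsep hFcov using hex
  have hcard : ∀ n, ((F n).card : ℝ≥0∞) * (r n : ℝ≥0∞) ^ (s : ℝ) ≤ C * μ univ := by
    intro n
    calc ((F n).card : ℝ≥0∞) * (r n : ℝ≥0∞) ^ (s : ℝ)
        = ∑ x ∈ F n, (r n : ℝ≥0∞) ^ (s : ℝ) := by simp
      _ ≤ ∑ x ∈ F n, C * μ (Metric.closedEBall x (r n)) :=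
          Finset.sum_le_sum fun x hx => hC x (hFE n hx) _ (hr0 n) (hr1 n)
      _ = C * ∑ x ∈ F n, μ (Metric.closedEBall x (r n)) := by rw [Finset.mul_sum]
      _ ≤ C * μ univ := by
          gcongr
          refine sum_measure_le_measure_univ
            (fun x _ => Metric.isClosed_closedEBall.measurableSet.nullMeasurableSet) ?_
          intro x hx y hy hxy
          refine Disjoint.aedisjoint (Set.disjoint_left.2 fun z hzx hzy => ?_)
          have h1 := hFsep n hx hy hxy
          have h2 : edist x y ≤ (r n : ℝ≥0∞) + r n :=
            (edist_triangle_left x y z).trans (add_le_add hzx hzy)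
          rw [ENNReal.coe_mul, ENNReal.coe_ofNat, two_mul] at h1
          exact absurd h1 h2.not_gt
  have hbound : ∀ n, ∑ x : F n, Metric.ediam (Metric.closedEBall (x : X) (2 * r n)) ^ (s : ℝ) ≤
      4 ^ (s : ℝ) * (C * μ univ) := by
    intro n
    calc _ ≤ ∑ x : F n, (4 * (r n : ℝ≥0∞)) ^ (s : ℝ) := by
          refine Finset.sum_le_sum fun x _ => ENNReal.rpow_le_rpow ?_ s.coe_nonneg
          refine Metric.ediam_closedEBall_le.trans_eq ?_
          rw [← mul_assoc]
          norm_num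
      _ = 4 ^ (s : ℝ) * (((F n).card : ℝ≥0∞) * (r n : ℝ≥0∞) ^ (s : ℝ)) := by
          simp only [Finset.sum_const, Finset.card_univ, Fintype.card_coe, nsmul_eq_mul]
          rw [ENNReal.mul_rpow_of_nonneg _ _ s.coe_nonneg]
          ring
      _ ≤ _ := by
          exact mul_le_mul_right (hcard n) _
  have hlim : Tendsto (fun n => 4 * (r n : ℝ≥0∞)) atTop (𝓝 0) := by
    have h : Tendsto r atTop (𝓝 0) := tendsto_one_div_add_atTop_nhds_zero_nat
    have := ENNReal.Tendsto.const_mul (a := 4) (ENNReal.tendsto_coe.2 h)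
      (Or.inr ENNReal.ofNat_ne_top)
    simpa using this
  refine dimH_le_of_hausdorffMeasure_ne_top (ne_top_of_le_ne_top ?_
    ((Measure.hausdorffMeasure_le_liminf_sum (s : ℝ) E (fun n => 4 * (r n : ℝ≥0∞)) hlim
      (fun n (x : F n) => Metric.closedEBall (x : X) (2 * r n)) ?_ ?_).trans
      ((liminf_le_liminf (Eventually.of_forall hbound)).trans_eq (liminf_const _))))
  · exact ENNReal.mul_ne_top (ENNReal.rpow_ne_top_of_nonneg s.coe_nonneg ENNReal.ofNat_ne_top)
      (ENNReal.mul_ne_top ENNReal.coe_ne_top (measure_ne_top _ _))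
  · refine Eventually.of_forall fun n x => Metric.ediam_closedEBall_le.trans_eq ?_
    rw [← mul_assoc]
    norm_num
  · refine Eventually.of_forall fun n => ?_
    have := Metric.isCover_iff_subset_iUnion_closedEBall.1 (hFcov n)
    refine this.trans (iUnion₂_subset fun x hx => ?_)
    have hx' := subset_iUnion (fun x : F n => Metric.closedEBall (x : X) (2 * r n)) ⟨x, hx⟩
    simpa using hx'

/-- To show that a push-forward probability charges a set, it suffices that almost every point is
mapped into it. -/
theorem map_apply_ne_zero_of_ae {Ω X : Type*} [MeasurableSpace Ω] [MeasurableSpace X]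
    {P : Measure Ω} [IsProbabilityMeasure P] {φ : Ω → X} (hφ : Measurable φ) {A : Set X}
    (h : ∀ᵐ ω ∂P, φ ω ∈ A) : P.map φ A ≠ 0 := by
  intro h0
  have h1 : ∀ᵐ ω ∂P, φ ω ∉ A := ae_of_ae_map hφ.aemeasurable (measure_eq_zero_iff_ae_notMem.1 h0)
  obtain ⟨ω, hω, hω'⟩ := (h.and h1).exists
  exact hω' hω

/-- Almost every sequence of independent digits agrees with a given sequence `w` on infinitely
many of the consecutive blocks of length `N`. -/
theorem ae_frequently_block_eq {α : Type*} [Fintype α] [MeasurableSpace α]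
    [MeasurableSingletonClass α] (p : PMF α) (hp : ∀ i, p i ≠ 0) (w : ℕ → α) (N : ℕ) :
    ∀ᵐ b ∂(Measure.infinitePi fun _ : ℕ => p.toMeasure),
      ∃ᶠ k in atTop, ∀ j ∈ Finset.Ico (k * N) ((k + 1) * N), b j = w j := by
  classical
  let B : ℕ → Finset ℕ := fun k => Finset.Ico (k * N) ((k + 1) * N)
  let E : ℕ → Set (ℕ → α) := fun k => Set.pi (B k : Set ℕ) fun j => {w j}
  have hcyl : ∀ F : Finset ℕ, (Measure.infinitePi fun _ : ℕ => p.toMeasure)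
      (Set.pi (F : Set ℕ) fun j => {w j}) = ∏ j ∈ F, p (w j) := by
    intro F
    rw [Measure.infinitePi_pi _ fun i _ => measurableSet_singleton _]
    exact Finset.prod_congr rfl fun j _ => p.toMeasure_apply_singleton _ (measurableSet_singleton _)
  have hmeas : ∀ k, MeasurableSet (E k) := fun k =>
    MeasurableSet.pi (Finset.countable_toSet _) fun j _ => measurableSet_singleton _
  have hB : Pairwise (Function.onFun Disjoint B) := by
    intro k l hkl
    refine Finset.disjoint_left.2 fun j hj hj' => hkl ?_
    simp only [B, Finset.mem_Ico] at hj hj'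
    have h1 : k < l + 1 := lt_of_mul_lt_mul_right (hj.1.trans_lt hj'.2) N.zero_le
    have h2 : l < k + 1 := lt_of_mul_lt_mul_right (hj'.1.trans_lt hj.2) N.zero_le
    lia
  have hind : iIndepSet E (Measure.infinitePi fun _ : ℕ => p.toMeasure) := by
    rw [iIndepSet_iff_meas_biInter hmeas]
    intro F
    have : ⋂ k ∈ F, E k = Set.pi (F.biUnion B : Set ℕ) fun j => {w j} := by
      ext b
      simp only [E, Set.mem_iInter, Set.mem_pi, Finset.mem_coe, Finset.mem_biUnion]
      exact ⟨fun h j ⟨k, hk, hj⟩ => h k hk j hj, fun h k hk j hj => h j ⟨k, hk, hj⟩⟩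
    rw [this, hcyl, Finset.prod_biUnion fun k _ l _ hkl => hB hkl]
    exact Finset.prod_congr rfl fun k _ => (hcyl _).symm
  have hsum : ∑' k, (Measure.infinitePi fun _ : ℕ => p.toMeasure) (E k) = ⊤ := by
    obtain ⟨i, -, hi⟩ := Finset.exists_min_image Finset.univ p ⟨w 0, Finset.mem_univ _⟩
    refine top_unique ?_
    rw [← ENNReal.tsum_const_eq_top_of_ne_zero (α := ℕ) (pow_ne_zero N (hp i))]
    refine ENNReal.tsum_le_tsum fun k => ?_
    rw [hcyl]
    refine le_trans (le_of_eq ?_) (Finset.prod_le_prod' fun j _ => hi (w j) (Finset.mem_univ _))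
    simp [B, add_mul]
  have hone := measure_limsup_eq_one hmeas hind hsum
  have hae := (mem_ae_iff_prob_eq_one (MeasurableSet.measurableSet_limsup hmeas)).2 hone
  filter_upwards [hae] with b hb
  rw [mem_limsup_iff_frequently_mem] at hb
  exact hb

theorem ae_prod_frequently_block_eq {α : Type*} [Fintype α] [MeasurableSpace α]
    [MeasurableSingletonClass α] (p : PMF α) (hp : ∀ i, p i ≠ 0) (d : α → α) (N : ℕ) :
    ∀ᵐ z ∂((Measure.infinitePi fun _ : ℕ => p.toMeasure).prod
        (Measure.infinitePi fun _ : ℕ => p.toMeasure)),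
      ∃ᶠ k in atTop, ∀ j ∈ Finset.Ico (k * N) ((k + 1) * N), z.2 j = d (z.1 j) := by
  rw [Measure.ae_prod_iff_ae_ae]
  · exact ae_of_all _ fun a => ae_frequently_block_eq p hp (fun j => d (a j)) N
  · simp only [frequently_atTop]
    have h : ∀ j, MeasurableSet {z : (ℕ → α) × (ℕ → α) | z.2 j = d (z.1 j)} := fun j =>
      measurableSet_eq_fun ((measurable_pi_apply j).comp measurable_snd)
        ((measurable_of_finite d).comp ((measurable_pi_apply j).comp measurable_fst))
    simp only [ofPred_forall, ofPred_exists, ofPred_and]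
    refine MeasurableSet.iInter fun n => MeasurableSet.iUnion fun k => ?_
    exact (MeasurableSet.const _).inter
      (MeasurableSet.iInter fun j => MeasurableSet.iInter fun _ => h j)

/-- The composition of the maps along the first `n` digits of `a`. -/
def prefixComp {α X : Type*} (S : α → X → X) (a : ℕ → α) : ℕ → X → X
  | 0 => id
  | n + 1 => prefixComp S a n ∘ S (a n)

theorem iterComp_eq_prefixComp {m : ℕ} {X : Type*} (S : Fin m → X → X) (a : ℕ → Fin m) (n : ℕ) :
    iterComp S a n = prefixComp S a (n + 1) := by
  induction n with
  | zero => rfl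
  | succ n ih => simp only [iterComp, ih, prefixComp]

theorem prefixComp_congr {α X : Type*} (S : α → X → X) {a b : ℕ → α} {n : ℕ}
    (h : ∀ i < n, a i = b i) : prefixComp S a n = prefixComp S b n := by
  induction n with
  | zero => rfl
  | succ n ih =>
    simp only [prefixComp, ih fun i hi => h i (hi.trans n.lt_succ_self), h n n.lt_succ_self]

theorem nndist_prefixComp {α X : Type*} [PseudoMetricSpace X] {S : α → X → X} {c : α → ℝ≥0}
    (hS : ∀ i x y, nndist (S i x) (S i y) = c i * nndist x y) (a : ℕ → α) (n : ℕ) (x y : X) :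
    nndist (prefixComp S a n x) (prefixComp S a n y) =
      (∏ i ∈ Finset.range n, c (a i)) * nndist x y := by
  induction n generalizing x y with
  | zero => simp [prefixComp]
  | succ n ih =>
    rw [prefixComp, Function.comp_apply, Function.comp_apply, ih, hS, Finset.prod_range_succ,
      mul_assoc]

/-- The point coded by `a` lies in the `n`-th cylinder of `a`, for every `n`. -/
theorem exists_eq_prefixComp {m : ℕ} {X : Type*} {S : Fin m → X → X} {K : Set X}
    {π : (ℕ → Fin m) → X} (hπ : ∀ s, (⋂ n, iterComp S s n '' K) = {π s}) (a : ℕ → Fin m) (n : ℕ) :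
    ∃ x ∈ S (a n) '' K, π a = prefixComp S a n x := by
  have h : π a ∈ ⋂ n, iterComp S a n '' K := by rw [hπ]; rfl
  obtain ⟨x, hx, hxa⟩ := Set.mem_iInter.1 h n
  rw [iterComp_eq_prefixComp] at hxa
  exact ⟨_, ⟨x, hx, rfl⟩, hxa.symm⟩

/-- Points whose codes share the first `n` digits are close. -/
theorem nndist_coding_le {m : ℕ} {X : Type*} [PseudoMetricSpace X] {S : Fin m → X → X}
    {c : Fin m → ℝ≥0} (hS : ∀ i x y, nndist (S i x) (S i y) = c i * nndist x y) {K : Set X}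
    (hSK : ∀ i, S i '' K ⊆ K) {π : (ℕ → Fin m) → X}
    (hπ : ∀ s, (⋂ n, iterComp S s n '' K) = {π s}) {D : ℝ≥0}
    (hD : ∀ x ∈ K, ∀ y ∈ K, nndist x y ≤ D) {a b : ℕ → Fin m} {n : ℕ}
    (hab : ∀ i < n, a i = b i) :
    nndist (π a) (π b) ≤ (∏ i ∈ Finset.range n, c (a i)) * D := by
  obtain ⟨x, hx, hxa⟩ := exists_eq_prefixComp hπ a n
  obtain ⟨y, hy, hyb⟩ := exists_eq_prefixComp hπ b n
  rw [hxa, hyb, ← prefixComp_congr S hab, nndist_prefixComp hS]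
  gcongr
  exact hD x (hSK _ hx) y (hSK _ hy)

/-- Points whose codes first differ at position `n` are far apart. -/
theorem le_nndist_coding {m : ℕ} {X : Type*} [PseudoMetricSpace X] {S : Fin m → X → X}
    {c : Fin m → ℝ≥0} (hS : ∀ i x y, nndist (S i x) (S i y) = c i * nndist x y) {K : Set X}
    {π : (ℕ → Fin m) → X} (hπ : ∀ s, (⋂ n, iterComp S s n '' K) = {π s}) {δ : ℝ≥0}
    (hδ : ∀ i j, i ≠ j → ∀ x ∈ S i '' K, ∀ y ∈ S j '' K, δ ≤ nndist x y) {a b : ℕ → Fin m} {n : ℕ}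
    (hab : ∀ i < n, a i = b i) (hn : a n ≠ b n) :
    (∏ i ∈ Finset.range n, c (a i)) * δ ≤ nndist (π a) (π b) := by
  obtain ⟨x, hx, hxa⟩ := exists_eq_prefixComp hπ a n
  obtain ⟨y, hy, hyb⟩ := exists_eq_prefixComp hπ b n
  rw [hxa, hyb, ← prefixComp_congr S hab, nndist_prefixComp hS]
  gcongr
  exact hδ _ _ hn x hx y hy

/-- Finitely many pairwise disjoint compact sets are uniformly separated. -/
theorem exists_pos_le_nndist_of_disjoint {ι X : Type*} [Finite ι] [MetricSpace X] {A : ι → Set X}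
    (hA : ∀ i, IsCompact (A i)) (hdisj : ∀ i j, i ≠ j → Disjoint (A i) (A j)) :
    ∃ δ : ℝ≥0, 0 < δ ∧ ∀ i j, i ≠ j → ∀ x ∈ A i, ∀ y ∈ A j, δ ≤ nndist x y := by
  have hpair : ∀ q : ι × ι, ∃ d : ℝ≥0, 0 < d ∧
      (q.1 ≠ q.2 → ∀ x ∈ A q.1, ∀ y ∈ A q.2, d ≤ nndist x y) := by
    rintro ⟨i, j⟩
    by_cases hij : i = j
    · exact ⟨1, one_pos, fun h => absurd hij h⟩
    obtain ⟨d, hd, hdis⟩ := (hdisj i j hij).exists_thickenings (hA i) (hA j).isClosed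
    refine ⟨⟨d, hd.le⟩, hd, fun _ x hx y hy => ?_⟩
    by_contra hlt
    exact Set.disjoint_left.1 hdis (Metric.self_subset_thickening hd _ hx)
      (Metric.mem_thickening_iff.2 ⟨y, hy, not_le.1 hlt⟩)
  choose d hd0 hd using hpair
  rcases isEmpty_or_nonempty (ι × ι) with h | h
  · exact ⟨1, one_pos, fun i j => (h.false (i, j)).elim⟩
  · obtain ⟨q, hq⟩ := Finite.exists_min d
    exact ⟨d q, hd0 q, fun i j hij x hx y hy => (hq (i, j)).trans (hd (i, j) hij x hx y hy)⟩

/-- Products of contraction ratios along sequences tend to zero uniformly. -/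
theorem exists_prod_range_lt {m : ℕ} {c : Fin m → ℝ≥0} (hc : ∀ i, c i < 1) {ε : ℝ≥0} (hε : 0 < ε) :
    ∃ N, ∀ a : ℕ → Fin m, ∏ i ∈ Finset.range N, c (a i) < ε := by
  rcases isEmpty_or_nonempty (Fin m) with h | h
  · exact ⟨0, fun a => isEmptyElim (a 0)⟩
  obtain ⟨i, hi⟩ := Finite.exists_max c
  obtain ⟨N, hN⟩ := exists_pow_lt_of_lt_one hε (hc i)
  refine ⟨N, fun a => lt_of_le_of_lt ?_ hN⟩
  refine (Finset.prod_le_prod' fun j _ => hi (a j)).trans_eq ?_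
  simp

/-- Points whose codes share sufficiently many digits are arbitrarily close. -/
theorem exists_nndist_coding_lt {m : ℕ} {X : Type*} [PseudoMetricSpace X] {S : Fin m → X → X}
    {c : Fin m → ℝ≥0} (hc : ∀ i, c i < 1)
    (hS : ∀ i x y, nndist (S i x) (S i y) = c i * nndist x y) {K : Set X} (hK : IsCompact K)
    (hSK : ∀ i, S i '' K ⊆ K) {π : (ℕ → Fin m) → X}
    (hπ : ∀ s, (⋂ n, iterComp S s n '' K) = {π s}) {ε : ℝ≥0} (hε : 0 < ε) :
    ∃ N, ∀ a b : ℕ → Fin m, (∀ i < N, a i = b i) → nndist (π a) (π b) < ε := by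
  obtain ⟨D, hD⟩ := Metric.isBounded_iff_nndist.1 hK.isBounded
  obtain ⟨N, hN⟩ := exists_prod_range_lt hc (div_pos hε (add_pos_of_nonneg_of_pos D.2 one_pos))
  refine ⟨N, fun a b hab => ?_⟩
  refine (nndist_coding_le hS hSK hπ (D := D + 1)
    (fun x hx y hy => (hD hx hy).trans le_self_add) hab).trans_lt ?_
  exact (lt_div_iff₀ (by positivity)).1 (hN a)

theorem continuous_coding {m : ℕ} {X : Type*} [PseudoMetricSpace X] {S : Fin m → X → X}
    {c : Fin m → ℝ≥0} (hc : ∀ i, c i < 1)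
    (hS : ∀ i x y, nndist (S i x) (S i y) = c i * nndist x y) {K : Set X} (hK : IsCompact K)
    (hSK : ∀ i, S i '' K ⊆ K) {π : (ℕ → Fin m) → X}
    (hπ : ∀ s, (⋂ n, iterComp S s n '' K) = {π s}) : Continuous π := by
  rw [continuous_iff_continuousAt]
  intro a
  refine Metric.tendsto_nhds.2 fun ε hε => ?_
  lift ε to ℝ≥0 using hε.le
  obtain ⟨N, hN⟩ := exists_nndist_coding_lt hc hS hK hSK hπ (NNReal.coe_pos.1 hε)
  have h : ∀ᶠ b : ℕ → Fin m in 𝓝 a, ∀ i ∈ Finset.range N, b i = a i := by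
    rw [Filter.eventually_all_finset]
    intro i _
    exact ((continuous_apply i).tendsto a).eventually_mem
      ((isOpen_discrete {a i}).mem_nhds (Set.mem_singleton _))
  filter_upwards [h] with b hb
  exact NNReal.coe_lt_coe.2 (hN b a fun i hi => hb i (Finset.mem_range.2 hi))

/-- Moran's equation `∑ c_i ^ s = 1` has a solution. -/
theorem exists_sum_rpow_eq_one {m : ℕ} (hm : 1 ≤ m) {c : Fin m → ℝ≥0} (hc : ∀ i, c i < 1)
    (hc0 : ∀ i, 0 < c i) : ∃ s : ℝ≥0, ∑ i, c i ^ (s : ℝ) = 1 := by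
  have hcont : Continuous fun s : ℝ => ∑ i, (c i : ℝ) ^ s :=
    continuous_finsetSum _ fun i _ =>
      continuous_const.rpow continuous_id fun _ => Or.inl (NNReal.coe_pos.2 (hc0 i)).ne'
  have hlim : Tendsto (fun s : ℝ => ∑ i, (c i : ℝ) ^ s) atTop (𝓝 0) := by
    have := tendsto_finsetSum (Finset.univ : Finset (Fin m)) fun i _ =>
      tendsto_rpow_atTop_of_base_lt_one (c i : ℝ)
        (neg_one_lt_zero.trans_le (c i).coe_nonneg) (hc i)
    simpa using this
  obtain ⟨t, ht, ht0⟩ := ((hlim.eventually_le_const one_pos).and (eventually_ge_atTop 0)).exists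
  have h0 : (1 : ℝ) ≤ ∑ i, (c i : ℝ) ^ (0 : ℝ) := by simpa using hm
  obtain ⟨s, hs, hs1⟩ := intermediate_value_Icc' ht0 hcont.continuousOn ⟨ht, h0⟩
  refine ⟨⟨s, hs.1⟩, NNReal.eq ?_⟩
  push_cast
  exact hs1

/-- The natural self-similar measure of a system of similitudes with separated images is Ahlfors
regular. -/
theorem exists_regular_bernoulli {m : ℕ} (hm : 1 ≤ m) {X : Type*} [MetricSpace X]
    [MeasurableSpace X] [BorelSpace X] {S : Fin m → X → X}
    {c : Fin m → ℝ≥0} (hc : ∀ i, c i < 1) (hc0 : ∀ i, 0 < c i)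
    (hS : ∀ i x y, nndist (S i x) (S i y) = c i * nndist x y) {K : Set X} (hK : IsCompact K)
    (hSK : ∀ i, S i '' K ⊆ K) (hdisj : ∀ i j, i ≠ j → Disjoint (S i '' K) (S j '' K))
    {π : (ℕ → Fin m) → X} (hπ : ∀ s, (⋂ n, iterComp S s n '' K) = {π s}) :
    ∃ (s : ℝ≥0) (p : PMF (Fin m)), (∀ i, p i ≠ 0) ∧
      IsUpperRegular ((Measure.infinitePi fun _ : ℕ => p.toMeasure).map π) s ∧
      IsLowerRegular ((Measure.infinitePi fun _ : ℕ => p.toMeasure).map π) s (range π) := by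
  have hSc : ∀ i, Continuous (S i) := fun i => by
    refine (LipschitzWith.of_dist_le_mul (K := c i) fun x y => ?_).continuous
    exact_mod_cast (hS i x y).le
  obtain ⟨δ, hδ0, hδ⟩ :=
    exists_pos_le_nndist_of_disjoint (fun i => hK.image (hSc i)) hdisj
  obtain ⟨D, hD1, hD⟩ : ∃ D : ℝ≥0, 1 ≤ D ∧ ∀ x ∈ K, ∀ y ∈ K, nndist x y ≤ D := by
    obtain ⟨D, hD⟩ := Metric.isBounded_iff_nndist.1 hK.isBounded
    exact ⟨D + 1, le_add_self, fun x hx y hy => (hD hx hy).trans le_self_add⟩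
  obtain ⟨s, hs⟩ := exists_sum_rpow_eq_one hm hc hc0
  let p : PMF (Fin m) := PMF.ofFintype (fun i => ((c i ^ (s : ℝ) : ℝ≥0) : ℝ≥0∞)) (by
    rw [← ENNReal.ofNNReal_finsetSum, hs, ENNReal.coe_one])
  have hp : ∀ i, p i = ((c i ^ (s : ℝ) : ℝ≥0) : ℝ≥0∞) := fun i => rfl
  have hπm : Measurable π := (continuous_coding hc hS hK hSK hπ).measurable
  have hcyl : ∀ (a : ℕ → Fin m) (n : ℕ), (Measure.infinitePi fun _ : ℕ => p.toMeasure)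
      {b | ∀ i < n, a i = b i} = (((∏ i ∈ Finset.range n, c (a i) : ℝ≥0) : ℝ≥0∞)) ^ (s : ℝ) := by
    intro a n
    have : {b : ℕ → Fin m | ∀ i < n, a i = b i} =
        Set.pi (Finset.range n : Set ℕ) fun i => {a i} := by
      ext b
      simp [Set.mem_pi, eq_comm]
    rw [this, Measure.infinitePi_pi _ fun i _ => measurableSet_singleton _,
      ← ENNReal.coe_rpow_of_nonneg _ s.coe_nonneg, ← NNReal.finsetProd_rpow,
      ENNReal.ofNNReal_finsetProd]
    exact Finset.prod_congr rfl fun j _ => p.toMeasure_apply_singleton _ (measurableSet_singleton _)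
  have hsmall : ∀ (a : ℕ → Fin m) {E r : ℝ≥0}, 0 < E → 0 < r →
      ∃ n, (∏ i ∈ Finset.range n, c (a i)) * E ≤ r := by
    intro a E r hE hr
    obtain ⟨n, hn⟩ := exists_prod_range_lt hc (div_pos hr hE)
    exact ⟨n, ((lt_div_iff₀ hE).1 (hn a)).le⟩
  refine ⟨s, p, fun i => ?_, ?_, ?_⟩
  · rw [hp]
    exact ENNReal.coe_ne_zero.2 (NNReal.rpow_pos (hc0 i)).ne'
  · refine ⟨(1 / δ) ^ (s : ℝ), fun A r hr hA => ?_⟩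
    rw [← ENNReal.coe_rpow_of_nonneg r s.coe_nonneg, ← ENNReal.coe_mul, ← NNReal.mul_rpow]
    have hAcl : Metric.ediam (closure A) ≤ r := by rwa [Metric.ediam_closure]
    refine (measure_mono subset_closure).trans ?_
    rw [Measure.map_apply hπm isClosed_closure.measurableSet]
    rcases (π ⁻¹' closure A).eq_empty_or_nonempty with h | ⟨a, ha⟩
    · simp [h]
    classical
    have hex := hsmall a hδ0 hr
    have hsub : π ⁻¹' closure A ⊆ {b | ∀ i < Nat.find hex, a i = b i} := by
      intro b hb
      have hab : nndist (π a) (π b) ≤ r := by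
        have := (Metric.edist_le_ediam_of_mem (s := closure A) (x := π a) (y := π b)
          ha hb).trans hAcl
        rwa [edist_nndist, ENNReal.coe_le_coe] at this
      intro i hi
      induction i using Nat.strong_induction_on with
      | _ i ih =>
        by_contra hne
        exact Nat.find_min hex hi ((le_nndist_coding hS hπ hδ
          (fun j hj => ih j hj (hj.trans hi)) hne).trans hab)
    refine (measure_mono hsub).trans ?_
    rw [hcyl, ← ENNReal.coe_rpow_of_nonneg _ s.coe_nonneg, ENNReal.coe_le_coe]
    refine NNReal.rpow_le_rpow ?_ s.coe_nonneg
    rw [one_div, mul_comm, ← div_eq_mul_inv, le_div_iff₀ hδ0]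
    exact Nat.find_spec hex
  · have : Nonempty (Fin m) := ⟨⟨0, hm⟩⟩
    obtain ⟨i₀, hi₀⟩ := Finite.exists_min c
    refine ⟨(D / c i₀) ^ (s : ℝ), ?_⟩
    rintro _ ⟨a, rfl⟩ r hr hr1
    classical
    have hex := hsmall a (one_pos.trans_le hD1) hr
    have hratio : r ≤ D / c i₀ * ∏ i ∈ Finset.range (Nat.find hex), c (a i) := by
      rw [div_mul_eq_mul_div, le_div_iff₀ (hc0 i₀)]
      rcases hn : Nat.find hex with _ | n
      · simpa using mul_le_mul' (hr1.trans hD1) (hc i₀).le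
      · have hlt := not_le.1 (Nat.find_min hex (n.lt_succ_self.trans_eq hn.symm))
        rw [Finset.prod_range_succ, ← mul_assoc, mul_comm D]
        exact mul_le_mul' hlt.le (hi₀ _)
    have hsub : {b | ∀ i < Nat.find hex, a i = b i} ⊆ π ⁻¹' Metric.closedEBall (π a) r := by
      intro b hb
      have := (nndist_coding_le hS hSK hπ hD hb).trans (Nat.find_spec hex)
      rw [Set.mem_preimage, Metric.mem_closedEBall, edist_comm, edist_nndist]
      exact_mod_cast this
    rw [Measure.map_apply hπm Metric.isClosed_closedEBall.measurableSet]
    refine le_trans ?_ (mul_le_mul_right (measure_mono hsub) _)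
    rw [hcyl, ← ENNReal.coe_rpow_of_nonneg _ s.coe_nonneg,
      ← ENNReal.coe_rpow_of_nonneg _ s.coe_nonneg, ← ENNReal.coe_mul, ENNReal.coe_le_coe,
      ← NNReal.mul_rpow]
    exact NNReal.rpow_le_rpow hratio s.coe_nonneg

theorem shiftZ_iterate_apply {m : ℕ} (n : ℕ) (t : ℤ → Fin m) (k : ℤ) :
    shiftZ^[n] t k = t (k + n) := by
  induction n generalizing t with
  | zero => simp
  | succ n ih =>
    rw [Function.iterate_succ_apply, ih, shiftZ]
    push_cast
    ring_nf

/-- A factor of the two-sided shift: sequences agreeing on arbitrarily long blocks at positive times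
and differing infinitely often code a Li-Yorke pair. -/
theorem mem_liYorkePairs_of_frequently {m : ℕ} {E : Type*} [PseudoMetricSpace E] {f : E → E}
    {Λ : Set E} {φ : (ℤ → Fin m) → E} (hΛ : Bornology.IsBounded Λ) (hφ : ∀ t, φ t ∈ Λ)
    (hconj : ∀ t, f (φ t) = φ (shiftZ t))
    (hclose : ∀ ε : ℝ, 0 < ε → ∃ N : ℕ, ∀ t t' : ℤ → Fin m,
      (∀ k : ℤ, -N < k → k ≤ N → t k = t' k) → dist (φ t) (φ t') < ε)
    {δ : ℝ} (hδ : 0 < δ) (hsep : ∀ t t' : ℤ → Fin m, t 1 ≠ t' 1 → δ ≤ dist (φ t) (φ t'))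
    {t t' : ℤ → Fin m}
    (hagree : ∀ N : ℕ, ∃ᶠ k : ℕ in atTop, ∀ j ∈ Finset.Ico (k * N) ((k + 1) * N),
      t' ((j : ℤ) + 1) = t ((j : ℤ) + 1))
    (hdiff : ∃ᶠ k : ℕ in atTop, t' ((k : ℤ) + 1) ≠ t ((k : ℤ) + 1)) :
    (φ t, φ t') ∈ liYorkePairs f Λ := by
  have hiter : ∀ (n : ℕ) t, f^[n] (φ t) = φ (shiftZ^[n] t) := fun n t =>
    ((show Function.Semiconj φ shiftZ f from fun t => (hconj t).symm).iterate_right n t).symm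
  obtain ⟨C, hC⟩ := Metric.isBounded_iff.1 hΛ
  have hbdd : IsBoundedUnder (· ≤ ·) atTop
      fun n : ℕ => dist (f^[n] (φ t)) (f^[n] (φ t')) := by
    refine isBoundedUnder_of ⟨C, fun n => ?_⟩
    rw [hiter, hiter]
    exact hC (hφ _) (hφ _)
  have hbdd' : IsBoundedUnder (· ≥ ·) atTop
      fun n : ℕ => dist (f^[n] (φ t)) (f^[n] (φ t')) :=
    isBoundedUnder_of ⟨0, fun n => dist_nonneg⟩
  refine ⟨hφ t, hφ t', le_antisymm (le_of_forall_pos_le_add fun ε hε => ?_) ?_, ?_⟩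
  · rw [zero_add]
    refine liminf_le_of_frequently_le ?_ hbdd'
    obtain ⟨N, hN⟩ := hclose ε hε
    have htend : Tendsto (fun k : ℕ => k * (2 * (N + 1)) + (N + 1)) atTop atTop :=
      tendsto_atTop_mono (fun k => (Nat.le_mul_of_pos_right k (by positivity)).trans
        (Nat.le_add_right _ _)) tendsto_id
    refine htend.frequently ((hagree (2 * (N + 1))).mono fun k hk => ?_)
    rw [hiter, hiter]
    refine (hN _ _ fun i hi hi' => ?_).le
    rw [shiftZ_iterate_apply, shiftZ_iterate_apply]
    have := hk (i + ((k * (2 * (N + 1)) + (N + 1) : ℕ) : ℤ) - 1).toNat (by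
      rw [Finset.mem_Ico, add_mul, one_mul]
      generalize k * (2 * (N + 1)) = M
      lia)
    rw [Int.toNat_of_nonneg (by
      generalize k * (2 * (N + 1)) = M
      lia), sub_add_cancel] at this
    exact this.symm
  · exact le_liminf_of_le hbdd.isCoboundedUnder_ge (Eventually.of_forall fun n => dist_nonneg)
  · refine hδ.trans_le (le_limsup_of_frequently_le (hdiff.mono fun k hk => ?_) hbdd)
    rw [hiter, hiter]
    refine hsep _ _ ?_
    rw [shiftZ_iterate_apply, shiftZ_iterate_apply, add_comm]
    exact hk.symm

/-- The two-sided sequence with digits `a` at positive positions and digits `b`, read backwards,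
at nonpositive positions. -/
def glueSeq {m : ℕ} (a b : ℕ → Fin m) : ℤ → Fin m := fun k =>
  if 0 < k then a (k - 1).toNat else b (-k).toNat

theorem glueSeq_natCast_add_one {m : ℕ} (a b : ℕ → Fin m) (n : ℕ) :
    glueSeq a b ((n : ℤ) + 1) = a n := by
  have h : (0 : ℤ) < n + 1 := by lia
  simp [glueSeq, h]

theorem glueSeq_neg_natCast {m : ℕ} (a b : ℕ → Fin m) (n : ℕ) :
    glueSeq a b (-(n : ℤ)) = b n := by
  simp [glueSeq]

/-- Let `S_1,…,S_m` and `G_1,…,G_m` (`m ≥ 2`) be contracting similitudes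
of `ℝ^{w₁}` and `ℝ^{w₂}` with separated compact sets `K₁`, `K₂`, attractors `Λ₁`, `Λ₂` and
coding maps `π₁`, `π₂`. Let `f` have invariant set `Λ = Λ₁ × Λ₂` and assume
`π(s̃) = (π₁((s_k)_{k≥1}), π₂((s_{1−k})_{k≥1}))` is a homeomorphism `Σ̃ → Λ` conjugating
the two-sided shift `σ` to `f`. Then the Li-Yorke pairs of `f` in `Λ` have full Hausdorff
dimension: `dim_H LY_f(Λ) = dim_H (Λ × Λ) = 2 dim_H Λ₁ + 2 dim_H Λ₂`. -/
theorem dimH_liYorkePairs_eq_of_conj_two_sided_shift (m w₁ w₂ : ℕ) (hm : 2 ≤ m)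
    (S : Fin m → EuclideanSpace ℝ (Fin w₁) → EuclideanSpace ℝ (Fin w₁))
    (G : Fin m → EuclideanSpace ℝ (Fin w₂) → EuclideanSpace ℝ (Fin w₂))
    (c : Fin m → ℝ) (hc : ∀ i, c i ∈ Set.Ioo (0 : ℝ) 1)
    (hS : ∀ i x y, dist (S i x) (S i y) = c i * dist x y)
    (g : Fin m → ℝ) (hg : ∀ i, g i ∈ Set.Ioo (0 : ℝ) 1)
    (hG : ∀ i x y, dist (G i x) (G i y) = g i * dist x y)
    (K₁ : Set (EuclideanSpace ℝ (Fin w₁))) (hK₁c : IsCompact K₁) (hK₁ne : K₁.Nonempty)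
    (hSK₁ : ∀ i, S i '' K₁ ⊆ K₁)
    (hdisj₁ : ∀ i j, i ≠ j → Disjoint (S i '' K₁) (S j '' K₁))
    (K₂ : Set (EuclideanSpace ℝ (Fin w₂))) (hK₂c : IsCompact K₂) (hK₂ne : K₂.Nonempty)
    (hGK₂ : ∀ i, G i '' K₂ ⊆ K₂)
    (hdisj₂ : ∀ i j, i ≠ j → Disjoint (G i '' K₂) (G j '' K₂))
    (Λ₁ : Set (EuclideanSpace ℝ (Fin w₁))) (hΛ₁c : IsCompact Λ₁) (hΛ₁ne : Λ₁.Nonempty)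
    (hΛ₁ : Λ₁ = ⋃ i, S i '' Λ₁)
    (Λ₂ : Set (EuclideanSpace ℝ (Fin w₂))) (hΛ₂c : IsCompact Λ₂) (hΛ₂ne : Λ₂.Nonempty)
    (hΛ₂ : Λ₂ = ⋃ i, G i '' Λ₂)
    (π₁ : (ℕ → Fin m) → EuclideanSpace ℝ (Fin w₁))
    (hπ₁ : ∀ s, (⋂ n, iterComp S s n '' K₁) = {π₁ s})
    (π₂ : (ℕ → Fin m) → EuclideanSpace ℝ (Fin w₂))
    (hπ₂ : ∀ s, (⋂ n, iterComp G s n '' K₂) = {π₂ s})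
    (f : EuclideanSpace ℝ (Fin w₁) × EuclideanSpace ℝ (Fin w₂) →
      EuclideanSpace ℝ (Fin w₁) × EuclideanSpace ℝ (Fin w₂))
    (hfΛ : f '' (Λ₁ ×ˢ Λ₂) = Λ₁ ×ˢ Λ₂)
    (e : (ℤ → Fin m) ≃ₜ (Λ₁ ×ˢ Λ₂ : Set (EuclideanSpace ℝ (Fin w₁) × EuclideanSpace ℝ (Fin w₂))))
    (he : ∀ t : ℤ → Fin m,
      (e t : EuclideanSpace ℝ (Fin w₁) × EuclideanSpace ℝ (Fin w₂)) =
        (π₁ (fun n : ℕ => t ((n : ℤ) + 1)), π₂ (fun n : ℕ => t (-(n : ℤ)))))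
    (hconj : ∀ t : ℤ → Fin m,
      f (e t : EuclideanSpace ℝ (Fin w₁) × EuclideanSpace ℝ (Fin w₂)) =
        (e (shiftZ t) : EuclideanSpace ℝ (Fin w₁) × EuclideanSpace ℝ (Fin w₂))) :
    dimH (liYorkePairs f (Λ₁ ×ˢ Λ₂)) = dimH ((Λ₁ ×ˢ Λ₂) ×ˢ (Λ₁ ×ˢ Λ₂)) ∧
    dimH ((Λ₁ ×ˢ Λ₂) ×ˢ (Λ₁ ×ˢ Λ₂)) = 2 * dimH Λ₁ + 2 * dimH Λ₂ := by
  have hm1 : 1 ≤ m := one_le_two.trans hm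
  lift c to Fin m → ℝ≥0 using fun i => (hc i).1.le
  lift g to Fin m → ℝ≥0 using fun i => (hg i).1.le
  have hS' : ∀ i x y, nndist (S i x) (S i y) = c i * nndist x y := fun i x y =>
    NNReal.eq (hS i x y)
  have hG' : ∀ i x y, nndist (G i x) (G i y) = g i * nndist x y := fun i x y =>
    NNReal.eq (hG i x y)
  have hc1 : ∀ i, c i < 1 := fun i => (hc i).2
  have hg1 : ∀ i, g i < 1 := fun i => (hg i).2
  obtain ⟨s₁, p, hp, hup₁, hlo₁⟩ :=
    exists_regular_bernoulli hm1 hc1 (fun i => (hc i).1) hS' hK₁c hSK₁ hdisj₁ hπ₁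
  obtain ⟨s₂, q, hq, hup₂, hlo₂⟩ :=
    exists_regular_bernoulli hm1 hg1 (fun i => (hg i).1) hG' hK₂c hGK₂ hdisj₂ hπ₂
  have hglue : ∀ a b, (e (glueSeq a b) : _ × _) = (π₁ a, π₂ b) := fun a b => by
    rw [he]
    simp only [glueSeq_natCast_add_one, glueSeq_neg_natCast]
  have hmem : ∀ a b, (π₁ a, π₂ b) ∈ Λ₁ ×ˢ Λ₂ := fun a b => hglue a b ▸ (e (glueSeq a b)).2
  have hcode : ∀ x ∈ Λ₁, ∀ y ∈ Λ₂, x ∈ range π₁ ∧ y ∈ range π₂ := fun x hx y hy => by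
    obtain ⟨t, ht⟩ := e.surjective ⟨(x, y), hx, hy⟩
    have h := he t
    rw [ht, Prod.mk.injEq] at h
    exact ⟨⟨_, h.1.symm⟩, ⟨_, h.2.symm⟩⟩
  have hr₁ : range π₁ = Λ₁ := by
    obtain ⟨y, hy⟩ := hΛ₂ne
    refine Subset.antisymm ?_ fun x hx => (hcode x hx y hy).1
    rintro _ ⟨a, rfl⟩
    exact (hmem a a).1
  have hr₂ : range π₂ = Λ₂ := by
    obtain ⟨x, hx⟩ := hΛ₁ne
    refine Subset.antisymm ?_ fun y hy => (hcode x hx y hy).2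
    rintro _ ⟨a, rfl⟩
    exact (hmem a a).2
  rw [hr₁] at hlo₁
  rw [hr₂] at hlo₂
  have hπ₁m := (continuous_coding hc1 hS' hK₁c hSK₁ hπ₁).measurable
  have hπ₂m := (continuous_coding hg1 hG' hK₂c hGK₂ hπ₂).measurable
  set P := Measure.infinitePi fun _ : ℕ => p.toMeasure
  set Q := Measure.infinitePi fun _ : ℕ => q.toMeasure
  have : IsProbabilityMeasure (P.map π₁) := Measure.isProbabilityMeasure_map hπ₁m.aemeasurable
  have : IsProbabilityMeasure (Q.map π₂) := Measure.isProbabilityMeasure_map hπ₂m.aemeasurable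
  have hdim₁ : dimH Λ₁ = s₁ := le_antisymm (hlo₁.dimH_le hΛ₁c)
    (hup₁.le_dimH (map_apply_ne_zero_of_ae hπ₁m (ae_of_all _ fun a => (hmem a a).1)))
  have hdim₂ : dimH Λ₂ = s₂ := le_antisymm (hlo₂.dimH_le hΛ₂c)
    (hup₂.le_dimH (map_apply_ne_zero_of_ae hπ₂m (ae_of_all _ fun a => (hmem a a).2)))
  have hupper : dimH ((Λ₁ ×ˢ Λ₂) ×ˢ (Λ₁ ×ˢ Λ₂)) ≤ ((s₁ + s₂ + (s₁ + s₂) : ℝ≥0) : ℝ≥0∞) :=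
    ((hlo₁.prod hlo₂).prod (hlo₁.prod hlo₂)).dimH_le
      ((hΛ₁c.prod hΛ₂c).prod (hΛ₁c.prod hΛ₂c))
  have hsub : liYorkePairs f (Λ₁ ×ˢ Λ₂) ⊆ (Λ₁ ×ˢ Λ₂) ×ˢ (Λ₁ ×ˢ Λ₂) := fun z hz => ⟨hz.1, hz.2.1⟩
  have hclose : ∀ ε : ℝ, 0 < ε → ∃ N : ℕ, ∀ t t' : ℤ → Fin m,
      (∀ k : ℤ, -N < k → k ≤ N → t k = t' k) →
        dist (e t : EuclideanSpace ℝ (Fin w₁) × EuclideanSpace ℝ (Fin w₂)) (e t') < ε := by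
    intro ε hε
    lift ε to ℝ≥0 using hε.le
    obtain ⟨N₁, hN₁⟩ :=
      exists_nndist_coding_lt hc1 hS' hK₁c hSK₁ hπ₁ (NNReal.coe_pos.1 hε)
    obtain ⟨N₂, hN₂⟩ :=
      exists_nndist_coding_lt hg1 hG' hK₂c hGK₂ hπ₂ (NNReal.coe_pos.1 hε)
    refine ⟨N₁ + N₂, fun t t' h => ?_⟩
    rw [he, he, Prod.dist_eq]
    exact max_lt (hN₁ _ _ fun i hi => h _ (by lia) (by lia))
      (hN₂ _ _ fun i hi => h _ (by lia) (by lia))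
  have hScont : ∀ i, Continuous (S i) := fun i => by
    refine (LipschitzWith.of_dist_le_mul (K := c i) fun x y => ?_).continuous
    exact (hS i x y).le
  obtain ⟨δ, hδ0, hδ⟩ :=
    exists_pos_le_nndist_of_disjoint (fun i => hK₁c.image (hScont i)) hdisj₁
  have hsep : ∀ t t' : ℤ → Fin m, t 1 ≠ t' 1 →
      (δ : ℝ) ≤ dist (e t : EuclideanSpace ℝ (Fin w₁) × EuclideanSpace ℝ (Fin w₂)) (e t') := by
    intro t t' h
    rw [he, he, Prod.dist_eq]
    refine le_max_of_le_left ?_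
    have := le_nndist_coding hS' hπ₁ hδ (a := fun n : ℕ => t ((n : ℤ) + 1))
      (b := fun n : ℕ => t' ((n : ℤ) + 1)) (n := 0) (by simp) (by simpa using h)
    rw [Finset.range_zero, Finset.prod_empty, one_mul] at this
    exact NNReal.coe_le_coe.2 this
  have hLY : ((P.map π₁).prod (Q.map π₂)).prod ((P.map π₁).prod (Q.map π₂))
      (liYorkePairs f (Λ₁ ×ˢ Λ₂)) ≠ 0 := by
    rw [Measure.map_prod_map _ _ hπ₁m hπ₂m,
      Measure.map_prod_map _ _ (hπ₁m.prodMap hπ₂m) (hπ₁m.prodMap hπ₂m)]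
    refine map_apply_ne_zero_of_ae ((hπ₁m.prodMap hπ₂m).prodMap (hπ₁m.prodMap hπ₂m)) ?_
    have hproj : MeasurePreserving (Prod.map Prod.fst Prod.fst) ((P.prod Q).prod (P.prod Q))
        (P.prod P) := measurePreserving_fst.prod measurePreserving_fst
    have : Nontrivial (Fin m) := Fin.nontrivial_iff_two_le.2 hm
    choose d hd using fun i : Fin m => exists_ne i
    have hagree := hproj.quasiMeasurePreserving.ae
      (ae_all_iff.2 fun N => ae_prod_frequently_block_eq p hp id N)
    have hdiff := hproj.quasiMeasurePreserving.ae (ae_prod_frequently_block_eq p hp d 1)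
    filter_upwards [hagree, hdiff] with ω hω hω'
    rw [Prod.map_apply', Prod.map_apply', Prod.map_apply', ← hglue, ← hglue]
    refine mem_liYorkePairs_of_frequently
      (φ := fun t => (e t : EuclideanSpace ℝ (Fin w₁) × EuclideanSpace ℝ (Fin w₂)))
      (hΛ₁c.prod hΛ₂c).isBounded (fun t => (e t).2) hconj hclose hδ0 hsep ?_ ?_
    · simp only [glueSeq_natCast_add_one]
      exact hω
    · simp only [glueSeq_natCast_add_one]
      refine hω'.mono fun k hk => ?_
      rw [show ω.2.1 k = d (ω.1.1 k) from hk k (by simp)]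
      exact hd _
  have hlower : ((s₁ + s₂ + (s₁ + s₂) : ℝ≥0) : ℝ≥0∞) ≤ dimH (liYorkePairs f (Λ₁ ×ˢ Λ₂)) :=
    ((hup₁.prod hup₂).prod (hup₁.prod hup₂)).le_dimH hLY
  refine ⟨le_antisymm (dimH_mono hsub) (hupper.trans hlower), ?_⟩
  rw [le_antisymm hupper (hlower.trans (dimH_mono hsub)), hdim₁, hdim₂]
  push_cast
  ring

end
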